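/- Let m ≥ 1 and let p, q be two probability vectors on {1,…,m}. For a probability vector p, define the inverse-CDF partition of [0,1] by I_p(1) = [0, p_1] and I_p(i) = ( Σ_{j=1}^{i-1} p_j , Σ_{j=1}^{i} p_j ] for i > 1, so that λ(I_p(i)) = p_i where λ is the Lebesgue measure. If |p_j − q_j| ≤ δ for every j ∈ {1,…,m}, then for each i, λ(I_p(i) ∩ I_q(i)) ≥ ( p_i − (2i − 1)δ )_+, and consequently Σ_{i=1}^{m} λ(I_p(i) ∩ I_q(i)) ≥ ( 1 − m² δ )_+. -/

import Mathlib

/-- `p` is a probability vector on `Fin m`. -/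
def IsProbVec {m : ℕ} (p : Fin m → ℝ) : Prop :=
  (∀ i, 0 ≤ p i) ∧ ∑ i, p i = 1

/-- The inverse-CDF partition of `[0,1]` associated with a probability vector `p` on
`{1,…,m}` (0-indexed as `Fin m`): the first interval is `[0, p 0]` and the `i`-th
interval is `(Σ_{j<i} p j, Σ_{j≤i} p j]`. -/
noncomputable def cdfInterval {m : ℕ} (p : Fin m → ℝ) (i : Fin m) : Set ℝ :=
  if (i : ℕ) = 0 then Set.Icc 0 (p i)
  else Set.Ioc (∑ j ∈ Finset.univ.filter (fun j => j < i), p j)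
               (∑ j ∈ Finset.univ.filter (fun j => j ≤ i), p j)

theorem cdf_aux_le {m : ℕ} (p : Fin m → ℝ) (i : Fin m) :
    ∑ j ∈ Finset.univ.filter (fun j => j ≤ i), p j =
      ∑ j ∈ Finset.univ.filter (fun j => j < i), p j + p i := by
  have h : Finset.univ.filter (fun j => j ≤ i) =
      insert i (Finset.univ.filter (fun j => j < i)) := by
    ext j
    simp [le_iff_eq_or_lt]
  rw [h, Finset.sum_insert (by simp), add_comm]

theorem cdf_aux_sub {m : ℕ} (p : Fin m → ℝ) (i : Fin m) :
    Set.Ioc (∑ j ∈ Finset.univ.filter (fun j => j < i), p j)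
      (∑ j ∈ Finset.univ.filter (fun j => j < i), p j + p i) ⊆ cdfInterval p i := by
  unfold cdfInterval
  split_ifs with h
  · have : Finset.univ.filter (fun j => j < i) = ∅ := by
      ext j
      simp [Fin.le_def, h]
    rw [this]
    simpa using Set.Ioc_subset_Icc_self
  · rw [cdf_aux_le]

theorem cdf_aux_fin {m : ℕ} (p : Fin m → ℝ) (i : Fin m) :
    MeasureTheory.volume (cdfInterval p i) ≠ ⊤ := by
  unfold cdfInterval
  split_ifs <;> simp

theorem cdf_aux_diff {m : ℕ} (p q : Fin m → ℝ) (δ : ℝ) (hδ : ∀ j, |p j - q j| ≤ δ)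
    (i : Fin m) :
    |∑ j ∈ Finset.univ.filter (fun j => j < i), p j -
      ∑ j ∈ Finset.univ.filter (fun j => j < i), q j| ≤ (i : ℕ) * δ := by
  rw [← Finset.sum_sub_distrib]
  refine (Finset.abs_sum_le_sum_abs _ _).trans ?_
  refine (Finset.sum_le_card_nsmul _ _ δ (fun j _ => hδ j)).trans ?_
  have : (Finset.univ.filter (fun j => j < i)).card = (i : ℕ) := by
    rw [show Finset.univ.filter (fun j => j < i) = Finset.Iio i by ext j; simp]
    exact Fin.card_Iio i
  rw [this, nsmul_eq_mul]

theorem cdf_aux_main {m : ℕ} (p q : Fin m → ℝ) (δ : ℝ) (hδ : ∀ j, |p j - q j| ≤ δ)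
    (i : Fin m) :
    p i - (2 * ((i : ℕ) + 1) - 1) * δ ≤
      (MeasureTheory.volume (cdfInterval p i ∩ cdfInterval q i)).toReal := by
  have hs := Set.inter_subset_inter (cdf_aux_sub p i) (cdf_aux_sub q i)
  have hd := cdf_aux_diff p q δ hδ i
  have hi := hδ i
  have hf : MeasureTheory.volume (cdfInterval p i ∩ cdfInterval q i) ≠ ⊤ :=
    MeasureTheory.measure_ne_top_of_subset Set.inter_subset_left (cdf_aux_fin p i)
  refine le_trans ?_ (ENNReal.toReal_mono hf (MeasureTheory.measure_mono hs))
  generalize ∑ j ∈ Finset.univ.filter (fun j => j < i), p j = A at *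
  generalize ∑ j ∈ Finset.univ.filter (fun j => j < i), q j = B at *
  rw [Set.Ioc_inter_Ioc, Real.volume_Ioc, ENNReal.toReal_ofReal']
  refine le_trans ?_ (le_max_left _ _)
  rw [abs_le] at hd hi
  have hδ0 : 0 ≤ δ := by linarith
  have h0 : 0 ≤ ((i : ℕ) : ℝ) * δ := by positivity
  have h1 : A ⊔ B ≤ A + (i : ℕ) * δ := sup_le (by linarith) (by linarith)
  have h2 : A + p i - ((i : ℕ) * δ + δ) ≤ (A + p i) ⊓ (B + q i) :=
    le_inf (by linarith) (by linarith)
  linarith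

theorem cdf_aux_sq (m : ℕ) : ∑ i : Fin m, (2 * (((i : ℕ) : ℝ) + 1) - 1) = (m : ℝ) ^ 2 := by
  rw [Fin.sum_univ_eq_sum_range (fun i : ℕ => (2 * ((i : ℝ) + 1) - 1))]
  induction m with
  | zero => simp
  | succ k ih => rw [Finset.sum_range_succ, ih]; push_cast; ring

/-- If two probability vectors `p, q` on `{1,…,m}` satisfy
`|p_j − q_j| ≤ δ` for every `j`, then the corresponding inverse-CDF intervals overlap:
`λ(I_p(i) ∩ I_q(i)) ≥ (p_i − (2i − 1)δ)_+` (with `i` the 1-based index), and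
`Σ_i λ(I_p(i) ∩ I_q(i)) ≥ (1 − m² δ)_+`. -/
theorem cdf_interval_overlap {m : ℕ} (hm : 1 ≤ m)
    (p q : Fin m → ℝ) (hp : IsProbVec p) (hq : IsProbVec q)
    (δ : ℝ) (hδ : ∀ j, |p j - q j| ≤ δ) :
    (∀ i : Fin m,
      (MeasureTheory.volume (cdfInterval p i ∩ cdfInterval q i)).toReal ≥
        max (p i - (2 * ((i : ℕ) + 1) - 1) * δ) 0) ∧
    (∑ i : Fin m, (MeasureTheory.volume (cdfInterval p i ∩ cdfInterval q i)).toReal ≥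
      max (1 - (m : ℝ) ^ 2 * δ) 0) := by
  refine ⟨fun i => max_le (cdf_aux_main p q δ hδ i) ENNReal.toReal_nonneg, ?_⟩
  refine max_le ?_ (Finset.sum_nonneg fun i _ => ENNReal.toReal_nonneg)
  refine le_trans (le_of_eq ?_) (Finset.sum_le_sum fun i _ => cdf_aux_main p q δ hδ i)
  rw [Finset.sum_sub_distrib, hp.2, ← Finset.sum_mul, cdf_aux_sq]
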